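/- Suppose K = Θ(n^C) for a fixed constant C ∈ (0, 1/2). Then with high probability as n → ∞, the number of edges of the densest K-vertex subgraph of G₀ ~ G(n,1/2) satisfies d_{ER,K}(G₀) = K²/4 + (K^{3/2}·√(log(n/K)))/2 + o(K^{3/2}). -/

import Mathlib

open Filter MeasureTheory Finset

noncomputable section

/-- Edge index type: unordered pairs of vertices of `Fin n`, encoded as ordered pairs `i < j`. -/
abbrev EdgeIdx (n : ℕ) := {p : Fin n × Fin n // p.1 < p.2}

/-- A graph on the vertex set `Fin n`, given by a boolean indicator on the possible edges. -/
abbrev ERGraph (n : ℕ) := EdgeIdx n → Bool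

/-- The number of edges of the subgraph of `g` induced on the vertex set `A`. -/
def edgeCount {n : ℕ} (g : ERGraph n) (A : Finset (Fin n)) : ℕ :=
  (Finset.univ.filter (fun p : EdgeIdx n => p.1.1 ∈ A ∧ p.1.2 ∈ A ∧ g p = true)).card

/-- The Erdős–Rényi `G(n,1/2)` distribution: the uniform measure over all graphs on `n`
labeled vertices (each edge present independently with probability `1/2`). -/
noncomputable def erMeasure (n : ℕ) : Measure (ERGraph n) :=
  (PMF.uniformOfFintype (ERGraph n)).toMeasure

/-- `d_{ER,K}(g)`: the number of edges of the densest `K`-vertex subgraph of `g`. -/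
def dER (n K : ℕ) (g : ERGraph n) : ℕ :=
  (Finset.powersetCard K (Finset.univ : Finset (Fin n))).sup (edgeCount g)

/-- The average of a real function over a finite type. -/
def avg {Ω : Type*} [Fintype Ω] (f : Ω → ℝ) : ℝ := (∑ g, f g) / Fintype.card Ω

section avg
variable {Ω : Type*} [Fintype Ω]

lemma avg_mono {f h : Ω → ℝ} (hfh : ∀ g, f g ≤ h g) : avg f ≤ avg h := by
  unfold avg
  gcongr with g
  exact hfh g

lemma avg_add (f h : Ω → ℝ) : avg (fun g => f g + h g) = avg f + avg h := by
  simp only [avg, Finset.sum_add_distrib, add_div]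

lemma avg_sub (f h : Ω → ℝ) : avg (fun g => f g - h g) = avg f - avg h := by
  simp only [avg, Finset.sum_sub_distrib, sub_div]

lemma avg_const_mul (c : ℝ) (f : Ω → ℝ) : avg (fun g => c * f g) = c * avg f := by
  simp only [avg, ← Finset.mul_sum, mul_div_assoc]

lemma avg_sum {α : Type*} (s : Finset α) (f : α → Ω → ℝ) :
    avg (fun g => ∑ a ∈ s, f a g) = ∑ a ∈ s, avg (f a) := by
  simp only [avg, Finset.sum_div]
  rw [Finset.sum_comm]

lemma sq_avg_le_mul_avg_support (Y : Ω → ℝ) :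
    (avg Y) ^ 2 ≤ avg (fun g => Y g ^ 2) * avg (fun g => if Y g ≠ 0 then (1 : ℝ) else 0) := by
  have h := Finset.sum_mul_sq_le_sq_mul_sq (univ : Finset Ω) Y
    (fun g => if Y g ≠ 0 then (1 : ℝ) else 0)
  have h1 : ∀ g, Y g * (if Y g ≠ 0 then (1 : ℝ) else 0) = Y g := by
    intro g; by_cases hg : Y g = 0 <;> simp [hg]
  have h2 : ∀ g, (if Y g ≠ 0 then (1 : ℝ) else 0) ^ 2 = if Y g ≠ 0 then (1 : ℝ) else 0 := by
    intro g; split_ifs <;> simp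
  simp only [h1, h2] at h
  simp only [avg]
  rw [div_pow, div_mul_div_comm, ← sq]
  gcongr

end avg

/-- The `±1` spin of a boolean. -/
def spin (b : Bool) : ℝ := if b then 1 else -1

lemma exp_le_cosh (θ : ℝ) : Real.exp (θ ^ 2 / 2 - θ ^ 4 / 8) ≤ Real.cosh θ := by
  have hs : (θ / 2) ^ 2 ≤ Real.sinh (θ / 2) ^ 2 := by
    rw [sq_le_sq, Real.abs_sinh]
    exact Real.self_le_sinh_iff.2 (abs_nonneg _)
  have hc : 1 + θ ^ 2 / 2 ≤ Real.cosh θ := by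
    have h2 : Real.cosh θ = Real.cosh (2 * (θ / 2)) := by congr 1; ring
    rw [h2, Real.cosh_two_mul, Real.cosh_sq]
    linarith
  refine le_trans ?_ hc
  have hx : 0 ≤ θ ^ 2 / 2 := by positivity
  rw [← Real.le_log_iff_exp_le (by positivity)]
  refine le_trans ?_ (Real.le_log_one_add_of_nonneg hx)
  rw [le_div_iff₀ (by positivity)]
  nlinarith [pow_nonneg hx 3]

lemma sinh_le_mul_cosh {θ : ℝ} (hθ : 0 ≤ θ) : Real.sinh θ ≤ θ * Real.cosh θ := by
  have hd : ∀ x : ℝ, HasDerivAt (fun x => x * Real.cosh x - Real.sinh x) (x * Real.sinh x) x := by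
    intro x
    have h := ((hasDerivAt_id' x).mul (Real.hasDerivAt_cosh x)).sub (Real.hasDerivAt_sinh x)
    exact h.congr_deriv (by simp)
  have hm : MonotoneOn (fun x => x * Real.cosh x - Real.sinh x) (Set.Ici 0) := by
    apply monotoneOn_of_deriv_nonneg (convex_Ici 0)
    · exact fun x _ => (hd x).continuousAt.continuousWithinAt
    · exact fun x _ => (hd x).differentiableAt.differentiableWithinAt
    · intro x hx
      rw [(hd x).deriv]
      rw [interior_Ici, Set.mem_Ioi] at hx
      exact mul_nonneg hx.le (Real.sinh_nonneg_iff.2 hx.le)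
  have := hm Set.self_mem_Ici hθ hθ
  simp at this
  linarith

lemma inv_cosh_pow_le (θ : ℝ) (m : ℕ) :
    (Real.cosh θ ^ m)⁻¹ ≤ Real.exp (m * (θ ^ 4 / 8 - θ ^ 2 / 2)) := by
  rw [inv_le_comm₀ (by positivity) (by positivity), ← Real.exp_neg]
  calc _ = Real.exp (θ ^ 2 / 2 - θ ^ 4 / 8) ^ m := by
        rw [← Real.exp_nat_mul]; congr 1; ring
    _ ≤ _ := by gcongr; exact exp_le_cosh θ

section spins
variable {ι : Type*}

/-- The total spin on a set of indices. -/
def spinSum (T : Finset ι) (g : ι → Bool) : ℝ := ∑ i ∈ T, spin (g i)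

/-- The likelihood ratio of the tilted law on `T`, truncated to typical values of the spin sum. -/
def tilt (θ w : ℝ) (T : Finset ι) (g : ι → Bool) : ℝ :=
  if |spinSum T g - #T * θ| ≤ w then Real.exp (θ * spinSum T g) / Real.cosh θ ^ #T else 0

lemma tilt_mul_tilt_le {θ θ' w : ℝ} (hθ : θ' ≤ θ) {T U : Finset ι} (hTU : #T = #U)
    (g : ι → Bool) :
    tilt θ w T g * tilt θ w U g ≤
      (Real.exp (2 * (θ - θ') * (#T * θ + w)) * ((Real.cosh θ ^ #T)⁻¹ * (Real.cosh θ ^ #T)⁻¹)) *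
        Real.exp (θ' * spinSum T g + θ' * spinSum U g) := by
  unfold tilt
  rw [← hTU]
  split_ifs with h1 h2
  · have e : Real.exp (θ * spinSum T g) / Real.cosh θ ^ #T *
        (Real.exp (θ * spinSum U g) / Real.cosh θ ^ #T) =
        ((Real.cosh θ ^ #T)⁻¹ * (Real.cosh θ ^ #T)⁻¹) *
          Real.exp (θ * spinSum T g + θ * spinSum U g) := by
      rw [Real.exp_add]; ring
    rw [e, mul_comm (Real.exp (2 * _ * _)), mul_assoc _ (Real.exp _) (Real.exp _), ← Real.exp_add]
    refine mul_le_mul_of_nonneg_left (Real.exp_le_exp.2 ?_) (by positivity)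
    have := (abs_le.1 h1).2
    have := (abs_le.1 h2).2
    nlinarith
  all_goals simp only [mul_zero, zero_mul]; positivity

variable [Fintype ι] [DecidableEq ι]

lemma avg_exp_sum_spin (c : ι → ℝ) :
    avg (fun g : ι → Bool => Real.exp (∑ i, c i * spin (g i))) = ∏ i, Real.cosh (c i) := by
  have h := (Finset.prod_univ_sum (fun _ : ι => (univ : Finset Bool))
    (fun i b => Real.exp (c i * spin b))).symm
  rw [Fintype.piFinset_univ] at h
  simp only [avg, Real.exp_sum, h]
  simp only [Fintype.sum_bool, spin, if_true, Bool.false_eq_true, if_false, Fintype.card_fun,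
    Fintype.card_bool, mul_one, mul_neg]
  have h2 : ∀ i, Real.exp (c i) + Real.exp (-c i) = 2 * Real.cosh (c i) := by
    intro i; rw [Real.cosh_eq]; ring
  simp only [h2, Finset.prod_mul_distrib, Finset.prod_const, Finset.card_univ]
  push_cast
  field_simp

lemma avg_exp_spinSum_add (u v : ℝ) (T U : Finset ι) :
    avg (fun g : ι → Bool => Real.exp (u * spinSum T g + v * spinSum U g)) =
      Real.cosh u ^ #(T \ U) * Real.cosh v ^ #(U \ T) * Real.cosh (u + v) ^ #(T ∩ U) := by
  have h := avg_exp_sum_spin (fun i : ι => (if i ∈ T then u else 0) + (if i ∈ U then v else 0))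
  have h1 : ∀ g : ι → Bool, ∑ i, ((if i ∈ T then u else 0) + (if i ∈ U then v else 0)) *
      spin (g i) = u * spinSum T g + v * spinSum U g := by
    intro g
    simp [add_mul, Finset.sum_add_distrib, spinSum, Finset.mul_sum, ite_mul]
  simp only [h1] at h
  rw [h]
  have h2 : ∀ i, Real.cosh ((if i ∈ T then u else 0) + (if i ∈ U then v else 0)) =
      (if i ∈ T \ U then Real.cosh u else 1) * (if i ∈ U \ T then Real.cosh v else 1) *
      (if i ∈ T ∩ U then Real.cosh (u + v) else 1) := by
    intro i
    by_cases hT : i ∈ T <;> by_cases hU : i ∈ U <;> simp [hT, hU]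
  simp only [h2, Finset.prod_mul_distrib, Finset.prod_ite_mem, Finset.univ_inter,
    Finset.prod_const]

lemma avg_exp_spinSum (u : ℝ) (T : Finset ι) :
    avg (fun g : ι → Bool => Real.exp (u * spinSum T g)) = Real.cosh u ^ #T := by
  simpa using avg_exp_spinSum_add u 0 T ∅

lemma avg_spinSum_ge_le {T : Finset ι} {N s : ℝ} (hN : (#T : ℝ) ≤ N) (hNpos : 0 < N)
    (hs : 0 ≤ s) :
    avg (fun g : ι → Bool => if s ≤ spinSum T g then (1 : ℝ) else 0) ≤
      Real.exp (-s ^ 2 / (2 * N)) := by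
  set u := s / N with hu
  have hu0 : 0 ≤ u := by positivity
  calc avg (fun g : ι → Bool => if s ≤ spinSum T g then (1 : ℝ) else 0)
      ≤ avg (fun g : ι → Bool => Real.exp (-u * s) * Real.exp (u * spinSum T g)) := by
        apply avg_mono
        intro g
        rw [← Real.exp_add]
        split_ifs with h
        · apply Real.one_le_exp
          nlinarith
        · positivity
    _ = Real.exp (-u * s) * Real.cosh u ^ #T := by
        rw [avg_const_mul, avg_exp_spinSum]
    _ ≤ Real.exp (-u * s) * Real.exp (u ^ 2 / 2) ^ #T := by
        gcongr
        exact Real.cosh_le_exp_half_sq u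
    _ ≤ Real.exp (-s ^ 2 / (2 * N)) := by
        rw [← Real.exp_nat_mul, ← Real.exp_add]
        apply Real.exp_le_exp.2
        have : (#T : ℝ) * (u ^ 2 / 2) ≤ N * (u ^ 2 / 2) := by gcongr
        have h3 : -u * s + N * (u ^ 2 / 2) = -s ^ 2 / (2 * N) := by
          rw [hu]; field_simp; ring
        linarith

lemma tilted_tail_le (θ u w : ℝ) (T : Finset ι) :
    avg (fun g : ι → Bool => Real.exp (u * (spinSum T g - #T * θ) - |u| * w) *
      (Real.exp (θ * spinSum T g) / Real.cosh θ ^ #T)) ≤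
      Real.exp (-|u| * w + #T * (u ^ 2 / 2 + θ ^ 4 / 8)) := by
  have h : ∀ g : ι → Bool, Real.exp (u * (spinSum T g - #T * θ) - |u| * w) *
      (Real.exp (θ * spinSum T g) / Real.cosh θ ^ #T) =
      (Real.exp (-u * #T * θ - |u| * w) * (Real.cosh θ ^ #T)⁻¹) *
        Real.exp ((u + θ) * spinSum T g) := by
    intro g
    rw [div_eq_mul_inv, ← mul_assoc, mul_right_comm _ (_⁻¹), ← Real.exp_add, ← Real.exp_add]
    congr 2
    ring
  simp only [h]
  rw [avg_const_mul, avg_exp_spinSum]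
  calc _ ≤ (Real.exp (-u * #T * θ - |u| * w) * Real.exp (#T * (θ ^ 4 / 8 - θ ^ 2 / 2))) *
        Real.exp ((u + θ) ^ 2 / 2) ^ #T := by
        gcongr
        · exact inv_cosh_pow_le _ _
        · exact Real.cosh_le_exp_half_sq _
    _ = _ := by
        rw [← Real.exp_nat_mul, ← Real.exp_add, ← Real.exp_add]
        congr 1; ring

lemma one_sub_le_avg_tilt {θ w N : ℝ} {T : Finset ι} (hw : 0 ≤ w) (hN : (#T : ℝ) ≤ N)
    (hNpos : 0 < N) :
    1 - 2 * Real.exp (-w ^ 2 / (2 * N) + N * θ ^ 4 / 8) ≤ avg (tilt θ w T) := by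
  set u := w / N with hu
  have hu0 : 0 ≤ u := by positivity
  have hmain : ∀ v : ℝ, |v| = u →
      Real.exp (-|v| * w + #T * (v ^ 2 / 2 + θ ^ 4 / 8)) ≤
      Real.exp (-w ^ 2 / (2 * N) + N * θ ^ 4 / 8) := by
    intro v hv
    apply Real.exp_le_exp.2
    rw [← sq_abs v, hv]
    have : (#T : ℝ) * (u ^ 2 / 2 + θ ^ 4 / 8) ≤ N * (u ^ 2 / 2 + θ ^ 4 / 8) := by gcongr
    have h3 : -u * w + N * (u ^ 2 / 2 + θ ^ 4 / 8) = -w ^ 2 / (2 * N) + N * θ ^ 4 / 8 := by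
      rw [hu]; field_simp; ring
    linarith
  have hp := (tilted_tail_le θ u w T).trans (hmain u (abs_of_nonneg hu0))
  have hm := (tilted_tail_le θ (-u) w T).trans (hmain (-u) (by rw [abs_neg, abs_of_nonneg hu0]))
  have h1 : avg (fun g : ι → Bool => Real.exp (θ * spinSum T g) / Real.cosh θ ^ #T) = 1 := by
    simp only [div_eq_inv_mul]
    rw [avg_const_mul, avg_exp_spinSum]
    have := Real.cosh_pos θ
    field_simp
  have key := avg_mono (Ω := ι → Bool)
    (f := fun g => Real.exp (θ * spinSum T g) / Real.cosh θ ^ #T -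
      (Real.exp (u * (spinSum T g - #T * θ) - |u| * w) *
      (Real.exp (θ * spinSum T g) / Real.cosh θ ^ #T) +
      Real.exp (-u * (spinSum T g - #T * θ) - |-u| * w) *
      (Real.exp (θ * spinSum T g) / Real.cosh θ ^ #T))) (h := tilt θ w T) (by
    intro g
    rw [abs_neg, abs_of_nonneg hu0]
    unfold tilt
    set D := spinSum T g - #T * θ
    have hL : 0 ≤ Real.exp (θ * spinSum T g) / Real.cosh θ ^ #T := by positivity
    set Λ := Real.exp (θ * spinSum T g) / Real.cosh θ ^ #T
    have e1 := Real.exp_pos (u * D - u * w)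
    have e2 := Real.exp_pos (-u * D - u * w)
    split_ifs with hD
    · nlinarith
    · rw [not_le, lt_abs] at hD
      rcases hD with hD | hD
      · have : 1 ≤ Real.exp (u * D - u * w) := Real.one_le_exp (by nlinarith)
        nlinarith
      · have : 1 ≤ Real.exp (-u * D - u * w) := Real.one_le_exp (by nlinarith)
        nlinarith)
  rw [avg_sub, avg_add, h1] at key
  linarith

lemma avg_tilt_mul_tilt_le {θ w : ℝ} {T U : Finset ι} (hTU : #T = #U) :
    avg (fun g => tilt θ w T g * tilt θ w U g) ≤ Real.exp (θ ^ 2 * #(T ∩ U)) := by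
  refine (avg_mono (tilt_mul_tilt_le (le_refl θ) hTU)).trans ?_
  rw [avg_const_mul, avg_exp_spinSum_add, sub_self, mul_zero, zero_mul, Real.exp_zero, one_mul]
  have hT := Finset.card_sdiff_add_card_inter T U
  have hU := Finset.card_sdiff_add_card_inter U T
  rw [Finset.inter_comm U T] at hU
  have hc := Real.cosh_pos θ
  have e : (Real.cosh θ ^ #T)⁻¹ * (Real.cosh θ ^ #T)⁻¹ * (Real.cosh θ ^ #(T \ U) *
      Real.cosh θ ^ #(U \ T) * Real.cosh (θ + θ) ^ #(T ∩ U)) =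
      (Real.cosh (θ + θ) / Real.cosh θ ^ 2) ^ #(T ∩ U) := by
    have hUT : #(U \ T) = #(T \ U) := by omega
    rw [← hT, hUT, div_pow]
    field_simp
    ring
  rw [e, mul_comm, Real.exp_nat_mul]
  gcongr
  rw [div_le_iff₀ (by positivity)]
  calc Real.cosh (θ + θ) = Real.cosh θ ^ 2 + Real.sinh θ ^ 2 := by
        rw [← two_mul, Real.cosh_two_mul]
    _ ≤ (θ ^ 2 + 1) * Real.cosh θ ^ 2 := by
        have h : |Real.sinh θ| ≤ |θ * Real.cosh θ| := by
          rw [Real.abs_sinh, abs_mul, abs_of_pos (Real.cosh_pos θ), ← Real.cosh_abs]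
          exact sinh_le_mul_cosh (abs_nonneg θ)
        have := sq_le_sq.2 h
        linarith [mul_pow θ (Real.cosh θ) 2]
    _ ≤ Real.exp (θ ^ 2) * Real.cosh θ ^ 2 := by
        gcongr
        exact Real.add_one_le_exp _

lemma avg_tilt_mul_tilt_le_of_card_inter {θ w x : ℝ} {T U : Finset ι} (hTU : #T = #U)
    (hθ : 0 ≤ θ) (hx : 0 ≤ x) (hw : 0 ≤ w) (hM : (#(T ∩ U) : ℝ) ≤ x ^ 2 * #T) :
    avg (fun g => tilt θ w T g * tilt θ w U g) ≤
      Real.exp ((#T * θ ^ 2 + 2 * θ * w) * x / 2 + #T * θ ^ 4 / 4) := by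
  set r := x ^ 2 / (1 + x ^ 2) with hr
  have hr0 : 0 ≤ r := by positivity
  have hrx : r ≤ x / 2 := by
    rw [hr, div_le_div_iff₀ (by positivity) (by positivity)]
    nlinarith [mul_nonneg hx (sq_nonneg (1 - x))]
  have hr1 : (1 - r) * (1 + x ^ 2) = 1 := by
    rw [hr]; field_simp; ring
  have hr1' : 0 ≤ 1 - r := by
    by_contra! h
    nlinarith [sq_nonneg x]
  refine (avg_mono (tilt_mul_tilt_le (θ' := θ * (1 - r)) (by nlinarith) hTU)).trans ?_
  rw [avg_const_mul, avg_exp_spinSum_add]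
  have hT := Finset.card_sdiff_add_card_inter T U
  have hU := Finset.card_sdiff_add_card_inter U T
  rw [Finset.inter_comm U T] at hU
  have hUT : #(U \ T) = #(T \ U) := by omega
  rw [hUT]
  have hTr : (#(T \ U) : ℝ) = #T - #(T ∩ U) := by
    rw [← hT]; push_cast; ring
  calc _ ≤ (Real.exp (2 * (θ - θ * (1 - r)) * (#T * θ + w)) *
        (Real.exp (#T * (θ ^ 4 / 8 - θ ^ 2 / 2)) * Real.exp (#T * (θ ^ 4 / 8 - θ ^ 2 / 2)))) *
        (Real.exp ((θ * (1 - r)) ^ 2 / 2) ^ #(T \ U) *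
        Real.exp ((θ * (1 - r)) ^ 2 / 2) ^ #(T \ U) *
        Real.exp ((θ * (1 - r) + θ * (1 - r)) ^ 2 / 2) ^ #(T ∩ U)) := by
        gcongr
        all_goals first | exact inv_cosh_pow_le _ _ | exact Real.cosh_le_exp_half_sq _
    _ ≤ _ := by
        simp only [← Real.exp_nat_mul, ← Real.exp_add]
        apply Real.exp_le_exp.2
        rw [hTr]
        set N : ℝ := (#T : ℝ)
        set M : ℝ := (#(T ∩ U) : ℝ)
        have hN : 0 ≤ N := by positivity
        have h1 : θ ^ 2 * (1 - r) ^ 2 * (N + M) ≤ θ ^ 2 * (1 - r) * N := by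
          calc θ ^ 2 * (1 - r) ^ 2 * (N + M) ≤ θ ^ 2 * (1 - r) ^ 2 * (N + x ^ 2 * N) := by gcongr
            _ = θ ^ 2 * (1 - r) * N * ((1 - r) * (1 + x ^ 2)) := by ring
            _ = _ := by rw [hr1, mul_one]
        have h2 : (N * θ ^ 2 + 2 * θ * w) * r ≤ (N * θ ^ 2 + 2 * θ * w) * (x / 2) := by gcongr
        nlinarith
end spins

/-- The possible edges inside `A`. -/
def edgesIn {n : ℕ} (A : Finset (Fin n)) : Finset (EdgeIdx n) :=
  univ.filter (fun p => p.1.1 ∈ A ∧ p.1.2 ∈ A)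

lemma edgesIn_inter {n : ℕ} (A B : Finset (Fin n)) :
    edgesIn A ∩ edgesIn B = edgesIn (A ∩ B) := by
  ext p
  simp only [edgesIn, mem_inter, mem_filter, mem_univ, true_and]
  tauto

lemma card_edgesIn {n : ℕ} (A : Finset (Fin n)) : #(edgesIn A) = (#A).choose 2 := by
  rw [← Finset.card_powersetCard]
  refine Finset.card_bij (fun p _ => {p.1.1, p.1.2}) ?_ ?_ ?_
  · intro p hp
    simp only [edgesIn, mem_filter, mem_univ, true_and] at hp
    rw [mem_powersetCard, Finset.card_pair p.2.ne]
    exact ⟨insert_subset hp.1 (singleton_subset_iff.2 hp.2), rfl⟩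
  · rintro ⟨⟨a, b⟩, hab⟩ _ ⟨⟨c, d⟩, hcd⟩ _ h
    simp only at hab hcd h
    have h1 : a ∈ ({c, d} : Finset (Fin n)) := h ▸ mem_insert_self _ _
    have h2 : b ∈ ({c, d} : Finset (Fin n)) := h ▸ mem_insert_of_mem (mem_singleton_self _)
    simp only [mem_insert, mem_singleton] at h1 h2
    simp only [Subtype.mk.injEq, Prod.mk.injEq]
    rcases h1 with rfl | rfl <;> rcases h2 with rfl | rfl
    · exact absurd hab (lt_irrefl _)
    · exact ⟨rfl, rfl⟩
    · exact absurd hab hcd.not_gt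
    · exact absurd hab (lt_irrefl _)
  · intro s hs
    rw [mem_powersetCard, Finset.card_eq_two] at hs
    obtain ⟨hs, x, y, hxy, rfl⟩ := hs
    have hx : x ∈ A := hs (mem_insert_self _ _)
    have hy : y ∈ A := hs (mem_insert_of_mem (mem_singleton_self _))
    rcases lt_or_gt_of_ne hxy with h | h
    · exact ⟨⟨(x, y), h⟩, by simp [edgesIn, hx, hy], rfl⟩
    · exact ⟨⟨(y, x), h⟩, by simp [edgesIn, hx, hy], Finset.pair_comm _ _⟩

lemma spinSum_edgesIn {n : ℕ} (A : Finset (Fin n)) (g : ERGraph n) :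
    spinSum (edgesIn A) g = 2 * edgeCount g A - (#A).choose 2 := by
  have h : ∀ b : Bool, spin b = 2 * (if b = true then (1 : ℝ) else 0) - 1 := by
    intro b; cases b
    · simp [spin]
    · norm_num [spin]
  have h2 : (univ.filter (fun p : EdgeIdx n => p.1.1 ∈ A ∧ p.1.2 ∈ A ∧ g p = true)) =
      (edgesIn A).filter (fun p => g p = true) := by
    ext p; simp [edgesIn, and_assoc]
  rw [spinSum, edgeCount, h2, ← card_edgesIn]
  simp only [h, Finset.sum_sub_distrib, ← Finset.mul_sum, Finset.sum_boole]
  simp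

lemma choose_sub_le {n k l : ℕ} (hk : k ≤ n) (hl : l ≤ k) :
    ((n - l).choose (k - l) : ℝ) ≤ n.choose k * ((k : ℝ) / n) ^ l := by
  induction l with
  | zero => simp
  | succ l ih =>
    have ih := ih (by omega)
    have h := Nat.add_one_mul_choose_eq (n - (l + 1)) (k - (l + 1))
    have e1 : n - (l + 1) + 1 = n - l := by omega
    have e2 : k - (l + 1) + 1 = k - l := by omega
    rw [e1, e2] at h
    have h' : ((n : ℝ) - l) * ((n - (l + 1)).choose (k - (l + 1)) : ℝ) =
        ((n - l).choose (k - l) : ℝ) * ((k : ℝ) - l) := by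
      rw [← Nat.cast_sub (by omega), ← Nat.cast_sub (by omega)]
      exact_mod_cast h
    have hn : (0 : ℝ) < n - l := by
      rw [sub_pos]; exact_mod_cast (by omega : l < n)
    have hn0 : (0 : ℝ) < n := by exact_mod_cast (by omega : 0 < n)
    have hq : ((k : ℝ) - l) / (n - l) ≤ k / n := by
      rw [div_le_div_iff₀ hn hn0]
      have : (k : ℝ) ≤ n := by exact_mod_cast hk
      nlinarith [(Nat.cast_nonneg l : (0 : ℝ) ≤ l)]
    have hkl : (0 : ℝ) ≤ k - l := by
      rw [sub_nonneg]; exact_mod_cast (by omega : l ≤ k)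
    calc ((n - (l + 1)).choose (k - (l + 1)) : ℝ)
        = ((n - l).choose (k - l) : ℝ) * (((k : ℝ) - l) / (n - l)) := by
          field_simp; linarith
      _ ≤ (n.choose k * ((k : ℝ) / n) ^ l) * (k / n) := by gcongr
      _ = _ := by ring

lemma card_filter_card_inter_le {n k l : ℕ} (hk : k ≤ n) (hl : l ≤ k) {A : Finset (Fin n)}
    (hA : #A = k) :
    (#{B ∈ powersetCard k (univ : Finset (Fin n)) | #(A ∩ B) = l} : ℝ) ≤
      n.choose k * (k.choose l * ((k : ℝ) / n) ^ l) := by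
  have hsub : {B ∈ powersetCard k (univ : Finset (Fin n)) | #(A ∩ B) = l} ⊆
      (powersetCard l A).biUnion (fun S => (powersetCard (k - l) Sᶜ).image (fun T => S ∪ T)) := by
    intro B hB
    simp only [mem_filter, mem_powersetCard, subset_univ, true_and] at hB
    simp only [mem_biUnion, mem_image, mem_powersetCard]
    refine ⟨A ∩ B, ⟨inter_subset_left, hB.2⟩, B \ (A ∩ B), ⟨?_, ?_⟩, ?_⟩
    · intro x hx
      exact mem_compl.2 (Finset.mem_sdiff.1 hx).2
    · rw [card_sdiff_of_subset inter_subset_right, hB.1, hB.2]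
    · exact union_sdiff_of_subset inter_subset_right
  have h1 : #{B ∈ powersetCard k (univ : Finset (Fin n)) | #(A ∩ B) = l} ≤
      k.choose l * (n - l).choose (k - l) := by
    refine (card_le_card hsub).trans ?_
    refine (card_biUnion_le_card_mul _ _ ((n - l).choose (k - l)) ?_).trans ?_
    · intro S hS
      refine card_image_le.trans ?_
      rw [card_powersetCard, card_compl, Fintype.card_fin, (mem_powersetCard.1 hS).2]
    · rw [card_powersetCard, hA]
  calc (#{B ∈ powersetCard k (univ : Finset (Fin n)) | #(A ∩ B) = l} : ℝ)
      ≤ k.choose l * (n - l).choose (k - l) := by exact_mod_cast h1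
    _ ≤ k.choose l * (n.choose k * ((k : ℝ) / n) ^ l) := by
        gcongr; exact choose_sub_le hk hl
    _ = _ := by ring

lemma sum_card_inter_le {n k : ℕ} (hk : k ≤ n) {A : Finset (Fin n)} (hA : #A = k) {r : ℕ → ℝ}
    (hr : ∀ l, 0 ≤ r l) :
    ∑ B ∈ powersetCard k (univ : Finset (Fin n)), r #(A ∩ B) ≤
      n.choose k * ∑ l ∈ range (k + 1), k.choose l * ((k : ℝ) / n) ^ l * r l := by
  have hm : ∀ B ∈ powersetCard k (univ : Finset (Fin n)), #(A ∩ B) ∈ range (k + 1) := by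
    intro B _
    rw [mem_range, Nat.lt_succ_iff, ← hA]
    exact card_le_card inter_subset_left
  rw [← Finset.sum_fiberwise_of_maps_to hm, Finset.mul_sum]
  apply Finset.sum_le_sum
  intro l hl
  have h := card_filter_card_inter_le hk (Nat.lt_succ_iff.1 (mem_range.1 hl)) hA
  calc ∑ B ∈ powersetCard k (univ : Finset (Fin n)) with #(A ∩ B) = l, r #(A ∩ B)
      = ∑ B ∈ powersetCard k (univ : Finset (Fin n)) with #(A ∩ B) = l, r l := by
        apply Finset.sum_congr rfl
        intro B hB
        rw [(mem_filter.1 hB).2]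
    _ = #{B ∈ powersetCard k (univ : Finset (Fin n)) | #(A ∩ B) = l} * r l := by
        rw [sum_const, nsmul_eq_mul]
    _ ≤ (n.choose k * (k.choose l * ((k : ℝ) / n) ^ l)) * r l := by
        gcongr; exact hr l
    _ = _ := by ring

lemma avg_dER_ge_of_second_moment {n k : ℕ} (hk : k ≤ n) {θ w δ : ℝ} (hδ0 : 0 ≤ δ) (hδ1 : δ ≤ 1)
    {r : ℕ → ℝ} (hr : ∀ l, 0 ≤ r l)
    (hpair : ∀ A B : Finset (Fin n), #A = k → #B = k →
      avg (fun g => tilt θ w (edgesIn A) g * tilt θ w (edgesIn B) g) ≤ r #(A ∩ B))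
    (hsum : ∑ l ∈ range (k + 1), k.choose l * ((k : ℝ) / n) ^ l * r l ≤ 1 + δ)
    (hfirst : ∀ A : Finset (Fin n), #A = k → 1 - δ ≤ avg (tilt θ w (edgesIn A))) :
    1 - 3 * δ ≤ avg (fun g : ERGraph n =>
      if (k.choose 2 * (1 + θ) - w) / 2 ≤ (dER n k g : ℝ) then (1 : ℝ) else 0) := by
  set P := powersetCard k (univ : Finset (Fin n)) with hP
  have hPc : (#P : ℝ) = n.choose k := by rw [hP, card_powersetCard]; simp
  have hmem : ∀ A ∈ P, #A = k := fun A hA => (mem_powersetCard.1 hA).2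
  have hB : (0 : ℝ) < n.choose k := by exact_mod_cast Nat.choose_pos hk
  set Y : ERGraph n → ℝ := fun g => ∑ A ∈ P, tilt θ w (edgesIn A) g with hY
  have hEY : (1 - δ) * n.choose k ≤ avg Y := by
    rw [hY, avg_sum]
    calc (1 - δ) * n.choose k = ∑ A ∈ P, (1 - δ) := by rw [sum_const, nsmul_eq_mul, hPc]; ring
      _ ≤ _ := Finset.sum_le_sum fun A hA => hfirst A (hmem A hA)
  have hEY2 : avg (fun g => Y g ^ 2) ≤ (1 + δ) * (n.choose k : ℝ) ^ 2 := by
    have e : (fun g => Y g ^ 2) = fun g => ∑ A ∈ P, ∑ B ∈ P,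
        tilt θ w (edgesIn A) g * tilt θ w (edgesIn B) g := by
      funext g
      rw [sq, hY, Finset.sum_mul_sum]
    rw [e, avg_sum]
    calc _ ≤ ∑ A ∈ P, (n.choose k : ℝ) * (1 + δ) := by
          apply Finset.sum_le_sum
          intro A hA
          rw [avg_sum]
          refine (Finset.sum_le_sum fun B hB => hpair A B (hmem A hA) (hmem B hB)).trans ?_
          refine (sum_card_inter_le hk (hmem A hA) hr).trans ?_
          gcongr
      _ = _ := by rw [sum_const, nsmul_eq_mul, hPc]; ring
  have hcs := sq_avg_le_mul_avg_support Y
  set p := avg (fun g => if Y g ≠ 0 then (1 : ℝ) else 0) with hp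
  have hp0 : 0 ≤ p := by
    have := avg_mono (Ω := ERGraph n) (f := fun _ => 0)
      (h := fun g => if Y g ≠ 0 then (1 : ℝ) else 0) (by intro g; split_ifs <;> simp)
    have h0 : avg (fun _ : ERGraph n => (0 : ℝ)) = 0 := by simp [avg]
    rwa [h0] at this
  have h1 : (1 - δ) ^ 2 ≤ (1 + δ) * p := by
    have h2 : ((1 - δ) * n.choose k) ^ 2 ≤ (avg Y) ^ 2 := by
      have : 0 ≤ 1 - δ := by linarith
      gcongr
    have h3 : avg (fun g => Y g ^ 2) * p ≤ (1 + δ) * (n.choose k : ℝ) ^ 2 * p := by gcongr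
    have h4 : (1 - δ) ^ 2 * (n.choose k : ℝ) ^ 2 ≤ (1 + δ) * p * (n.choose k : ℝ) ^ 2 := by
      nlinarith
    exact le_of_mul_le_mul_right h4 (by positivity)
  have hp1 : 1 - 3 * δ ≤ p := by nlinarith
  refine hp1.trans (avg_mono ?_)
  intro g
  by_cases hg : Y g = 0
  · simp only [hg, ne_eq, not_true_eq_false, if_false]
    split_ifs <;> simp
  · rw [if_pos hg, if_pos]
    obtain ⟨A, hA, hAne⟩ := Finset.exists_ne_zero_of_sum_ne_zero hg
    unfold tilt at hAne
    have habs : |spinSum (edgesIn A) g - #(edgesIn A) * θ| ≤ w := by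
      by_contra h
      exact hAne (if_neg h)
    rw [spinSum_edgesIn, card_edgesIn, hmem A hA] at habs
    have hle : edgeCount g A ≤ dER n k g := Finset.le_sup (f := edgeCount g) hA
    have hle' : (edgeCount g A : ℝ) ≤ dER n k g := by exact_mod_cast hle
    have := (abs_le.1 habs).1
    linarith

lemma avg_dER_gt_le {n k : ℕ} {s N : ℝ} (hN : (k.choose 2 : ℝ) ≤ N) (hNpos : 0 < N)
    (hs : 0 ≤ s) :
    avg (fun g : ERGraph n => if (N + s) / 2 < (dER n k g : ℝ) then (1 : ℝ) else 0) ≤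
      n.choose k * Real.exp (-s ^ 2 / (2 * N)) := by
  set P := powersetCard k (univ : Finset (Fin n)) with hP
  calc _ ≤ avg (fun g : ERGraph n => ∑ A ∈ P,
        if s ≤ spinSum (edgesIn A) g then (1 : ℝ) else 0) := by
        apply avg_mono
        intro g
        have hnn : ∀ A ∈ P, (0 : ℝ) ≤ if s ≤ spinSum (edgesIn A) g then (1 : ℝ) else 0 := by
          intro A _; split_ifs <;> simp
        split_ifs with h
        · have hne : P.Nonempty := by
            by_contra hne
            rw [not_nonempty_iff_eq_empty] at hne
            rw [dER, ← hP, hne] at h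
            simp only [sup_empty, bot_eq_zero, Nat.cast_zero] at h
            linarith
          obtain ⟨A, hA, hAe⟩ := Finset.exists_mem_eq_sup P hne (edgeCount g)
          have hd : (dER n k g : ℝ) = edgeCount g A := by rw [dER, ← hP, hAe]
          have hsA : s ≤ spinSum (edgesIn A) g := by
            rw [spinSum_edgesIn, (mem_powersetCard.1 hA).2]
            linarith
          have := Finset.single_le_sum hnn hA
          rwa [if_pos hsA] at this
        · exact Finset.sum_nonneg hnn
    _ ≤ ∑ A ∈ P, Real.exp (-s ^ 2 / (2 * N)) := by
        rw [avg_sum]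
        apply Finset.sum_le_sum
        intro A hA
        apply avg_spinSum_ge_le _ hNpos hs
        rwa [card_edgesIn, (mem_powersetCard.1 hA).2]
    _ = _ := by
        rw [sum_const, nsmul_eq_mul, hP, card_powersetCard]; simp

lemma choose_le_exp {n k : ℕ} (hk0 : 0 < k) (hkn : k ≤ n) :
    (n.choose k : ℝ) ≤ Real.exp (k * (Real.log (n / k) + 1)) := by
  have hk : (0 : ℝ) < k := by exact_mod_cast hk0
  have hn : (0 : ℝ) < n := by exact_mod_cast (by omega : 0 < n)
  have h1 : (n.choose k : ℝ) ≤ (n : ℝ) ^ k / k.factorial := Nat.choose_le_pow_div k n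
  have h2 : (k : ℝ) ^ k / k.factorial ≤ Real.exp k := Real.pow_div_factorial_le_exp _ hk.le _
  calc (n.choose k : ℝ) ≤ (n : ℝ) ^ k / k.factorial := h1
    _ = ((n : ℝ) / k) ^ k * ((k : ℝ) ^ k / k.factorial) := by
        rw [div_pow]; field_simp
    _ ≤ ((n : ℝ) / k) ^ k * Real.exp k := by gcongr
    _ = _ := by
        rw [mul_add, Real.exp_add, mul_one, Real.exp_nat_mul, Real.exp_log (by positivity)]

/-- A bound on the pair correlations of the tilted weights at overlap `l`: the untruncated second
moment for overlap at most `x * k`, and a truncated one beyond. -/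
def overlapBound (k : ℕ) (θ w x : ℝ) (l : ℕ) : ℝ :=
  if (l : ℝ) ≤ x * k then Real.exp (θ ^ 2 * l.choose 2)
  else Real.exp ((k.choose 2 * θ ^ 2 + 2 * θ * w) * (l / k) / 2 + k.choose 2 * θ ^ 4 / 4)

lemma overlapBound_nonneg (k : ℕ) (θ w x : ℝ) (l : ℕ) : 0 ≤ overlapBound k θ w x l := by
  unfold overlapBound; split_ifs <;> positivity

lemma avg_tilt_mul_tilt_edgesIn_le {n k : ℕ} (hk0 : 0 < k) {θ w x : ℝ} (hθ : 0 ≤ θ)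
    (hw : 0 ≤ w) {A B : Finset (Fin n)} (hA : #A = k) (hB : #B = k) :
    avg (fun g => tilt θ w (edgesIn A) g * tilt θ w (edgesIn B) g) ≤
      overlapBound k θ w x #(A ∩ B) := by
  have hk : (0 : ℝ) < k := by exact_mod_cast hk0
  have hcard : #(edgesIn A) = #(edgesIn B) := by rw [card_edgesIn, card_edgesIn, hA, hB]
  have hl : (#(A ∩ B) : ℝ) ≤ k := by
    rw [← hA]; exact_mod_cast card_le_card inter_subset_left
  unfold overlapBound
  split_ifs with h
  · have := avg_tilt_mul_tilt_le (θ := θ) (w := w) hcard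
    rwa [edgesIn_inter, card_edgesIn] at this
  · have := avg_tilt_mul_tilt_le_of_card_inter (θ := θ) (w := w) (x := (#(A ∩ B) : ℝ) / k)
      hcard hθ (by positivity) hw (by
        rw [edgesIn_inter, card_edgesIn, card_edgesIn, hA, Nat.cast_choose_two,
          Nat.cast_choose_two, div_pow, div_mul_div_comm, div_le_div_iff₀ (by norm_num)
          (by positivity)]
        set l : ℝ := (#(A ∩ B) : ℝ)
        have hl0 : 0 ≤ l := by positivity
        have h1 : 0 ≤ l * k * (k - l) := by
          have : 0 ≤ k - l := by linarith
          positivity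
        nlinarith)
    rwa [card_edgesIn A, hA] at this

lemma choose_two_le (k : ℕ) : (k.choose 2 : ℝ) ≤ (k : ℝ) ^ 2 / 2 := by
  rw [Nat.cast_choose_two]
  nlinarith [(Nat.cast_nonneg k : (0 : ℝ) ≤ k)]

lemma choose_mul_overlapBound_le {n k l : ℕ} (hkn : k ≤ n) (hl0 : 0 < l)
    (hlk : l ≤ k) {a L x : ℝ} (ha : 0 < a) (hL : L = Real.log (n / k)) (hx : 0 < x)
    (haL : a ≤ √L) (hLk : 2 * L ^ 2 ≤ k) (hxL : 3 ≤ x * a * √L) :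
    k.choose l * ((k : ℝ) / n) ^ l *
        overlapBound k (2 * (√L - a) / √k) (a / 2 * (k * √k)) x l ≤
      (k * (k / n) * Real.exp (2 * L * x)) ^ l + Real.exp (-k) := by
  have hk : (0 : ℝ) < k := by exact_mod_cast (by omega : 0 < k)
  have hn : (0 : ℝ) < n := by exact_mod_cast (by omega : 0 < n)
  have hl : (0 : ℝ) < l := by exact_mod_cast hl0
  have hlk' : (l : ℝ) ≤ k := by exact_mod_cast hlk
  have hkn' : (k : ℝ) ≤ n := by exact_mod_cast hkn
  have hL0 : 0 ≤ L := by
    rw [hL]; exact Real.log_nonneg ((one_le_div hk).2 hkn')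
  set τ := √L - a with hτ
  have hτ0 : 0 ≤ τ := by linarith
  have hsL := Real.sq_sqrt hL0
  have hτL : τ ^ 2 ≤ L := by nlinarith
  have hsk : 0 < √(k : ℝ) := Real.sqrt_pos.2 hk
  have hsk2 : √(k : ℝ) ^ 2 = k := Real.sq_sqrt hk.le
  have hθ2 : (2 * τ / √k) ^ 2 = 4 * τ ^ 2 / k := by
    rw [div_pow, hsk2]; ring
  have hexpL : (k : ℝ) / n = Real.exp (-L) := by
    rw [hL, Real.exp_neg, Real.exp_log (by positivity), inv_div]
  unfold overlapBound
  split_ifs with h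
  · have h1 : (k.choose l : ℝ) ≤ (k : ℝ) ^ l := by exact_mod_cast Nat.choose_le_pow k l
    have h2 : (2 * τ / √k) ^ 2 * (l.choose 2 : ℝ) ≤ l * (2 * L * x) := by
      calc _ ≤ 4 * τ ^ 2 / k * ((l : ℝ) ^ 2 / 2) := by
            rw [hθ2]; gcongr; exact choose_two_le l
        _ = 2 * τ ^ 2 * l * l / k := by ring
        _ ≤ 2 * L * l * (x * k) / k := by gcongr
        _ = _ := by field_simp
    calc _ ≤ (k : ℝ) ^ l * ((k : ℝ) / n) ^ l * Real.exp (l * (2 * L * x)) := by gcongr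
      _ = (k * (k / n) * Real.exp (2 * L * x)) ^ l := by
          rw [Real.exp_nat_mul]; ring
      _ ≤ _ := by linarith [Real.exp_pos (-(k : ℝ))]
  · push Not at h
    have h1 : (k.choose l : ℝ) ≤ Real.exp k := by
      calc (k.choose l : ℝ) ≤ (2 : ℝ) ^ k := by exact_mod_cast Nat.choose_le_two_pow k l
        _ ≤ Real.exp 1 ^ k := by
            gcongr
            linarith [Real.exp_one_gt_d9]
        _ = _ := by rw [← Real.exp_nat_mul, mul_one]
    have h2 : (k.choose 2 : ℝ) * (2 * τ / √k) ^ 2 ≤ 2 * k * τ ^ 2 := by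
      calc _ ≤ (k : ℝ) ^ 2 / 2 * (4 * τ ^ 2 / k) := by
            rw [hθ2]; gcongr; exact choose_two_le k
        _ = _ := by field_simp; ring
    have h3 : (k.choose 2 : ℝ) * (2 * τ / √k) ^ 4 / 4 ≤ k := by
      have e : (2 * τ / √k) ^ 4 = (4 * τ ^ 2 / k) ^ 2 := by rw [← hθ2]; ring
      calc _ ≤ (k : ℝ) ^ 2 / 2 * (4 * L / k) ^ 2 / 4 := by
            rw [e]; gcongr; exact choose_two_le k
        _ = 2 * L ^ 2 := by field_simp; ring
        _ ≤ k := hLk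
    have h4 : 2 * (2 * τ / √k) * (a / 2 * (k * √k)) = 2 * k * (τ * a) := by
      field_simp
    have h5 : ((k.choose 2 : ℝ) * (2 * τ / √k) ^ 2 + 2 * (2 * τ / √k) * (a / 2 * (k * √k))) *
        (l / k) / 2 + (k.choose 2 : ℝ) * (2 * τ / √k) ^ 4 / 4 ≤ l * (L - a * √L) + k := by
      have e : (2 * k * τ ^ 2 + 2 * k * (τ * a)) * (l / k) / 2 = l * (L - a * √L) := by
        field_simp
        rw [hτ, ← hsL]
        ring_nf
        rw [Real.sqrt_sq (Real.sqrt_nonneg L)]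
        ring
      rw [h4]
      calc _ ≤ (2 * k * τ ^ 2 + 2 * k * (τ * a)) * (l / k) / 2 + k := by gcongr
        _ = _ := by rw [e]
    calc _ ≤ Real.exp k * Real.exp (-L) ^ l * Real.exp (l * (L - a * √L) + k) := by
          rw [hexpL]; gcongr
      _ = Real.exp (2 * k - l * (a * √L)) := by
          rw [← Real.exp_nat_mul, ← Real.exp_add, ← Real.exp_add]; congr 1; ring
      _ ≤ Real.exp (-k) := by
          apply Real.exp_le_exp.2
          have : (x * k) * (a * √L) ≤ l * (a * √L) := by gcongr
          nlinarith
      _ ≤ _ := by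
          have : 0 ≤ (k * (k / n) * Real.exp (2 * L * x)) ^ l := by positivity
          linarith

lemma sum_choose_mul_overlapBound_le {n k : ℕ} (hk0 : 0 < k) (hkn : k ≤ n)
    {a L x q : ℝ} (ha : 0 < a) (hL : L = Real.log (n / k)) (hx : 0 < x)
    (haL : a ≤ √L) (hLk : 2 * L ^ 2 ≤ k) (hxL : 3 ≤ x * a * √L)
    (hq : k * (k / n) * Real.exp (2 * L * x) ≤ q) (hq2 : q ≤ 1 / 2) :
    ∑ l ∈ range (k + 1), k.choose l * ((k : ℝ) / n) ^ l *
        overlapBound k (2 * (√L - a) / √k) (a / 2 * (k * √k)) x l ≤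
      1 + (2 * q + k * Real.exp (-k)) := by
  have hq00 : 0 ≤ k * (k / n) * Real.exp (2 * L * x) := by positivity
  have hq0 : 0 ≤ q := hq00.trans hq
  rw [Finset.sum_range_succ']
  have h0 : overlapBound k (2 * (√L - a) / √k) (a / 2 * (k * √k)) x 0 = 1 := by
    unfold overlapBound
    rw [if_pos]
    · simp
    · push_cast; positivity
  rw [h0]
  have h1 : ∑ l ∈ range k, (k.choose (l + 1) * ((k : ℝ) / n) ^ (l + 1) *
        overlapBound k (2 * (√L - a) / √k) (a / 2 * (k * √k)) x (l + 1)) ≤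
      ∑ l ∈ range k, (q * (1 / 2) ^ l + Real.exp (-k)) := by
    apply Finset.sum_le_sum
    intro l hl
    refine (choose_mul_overlapBound_le hkn (Nat.succ_pos l) (mem_range.1 hl) ha hL hx haL hLk
      hxL).trans ?_
    rw [pow_succ']
    have : (k * (k / n) * Real.exp (2 * L * x)) ^ l ≤ (1 / 2) ^ l :=
      pow_le_pow_left₀ hq00 (hq.trans hq2) l
    gcongr
  have h2 : ∑ l ∈ range k, ((1 : ℝ) / 2) ^ l ≤ 2 := sum_geometric_two_le k
  rw [Finset.sum_add_distrib, ← Finset.mul_sum, sum_const, card_range, nsmul_eq_mul] at h1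
  simp only [Nat.choose_zero_right, Nat.cast_one, pow_zero, mul_one]
  nlinarith

lemma avg_dER_close_ge {n k : ℕ} (hk0 : 0 < k) (hkn : k ≤ n) {ε L x q δ : ℝ} (hε : 0 < ε)
    (hL : L = Real.log (n / k)) (hx : 0 < x) (hεL : ε ≤ √L) (hLk : 2 * L ^ 2 ≤ k)
    (hLk' : 8 * L ^ 2 ≤ ε ^ 2 * k) (hxL : 3 ≤ x * ε * √L) (hεL' : 2 ≤ 4 * ε * √L)
    (hεk : 2 ≤ √k * ε) (hkL : 4 * √L ≤ k * ε)
    (hq : k * (k / n) * Real.exp (2 * L * x) ≤ q) (hq2 : q ≤ 1 / 2)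
    (hδ1 : δ ≤ 1) (hqδ : 2 * q + k * Real.exp (-k) ≤ δ)
    (hδk : 2 * Real.exp (-(ε ^ 2 * k / 8)) ≤ δ) :
    1 - 4 * δ ≤ avg (fun g : ERGraph n =>
      if |(dER n k g : ℝ) - ((k : ℝ) ^ 2 / 4 + (k * √k) * √L / 2)| ≤ ε * (k * √k)
        then (1 : ℝ) else 0) := by
  have hk : (0 : ℝ) < k := by exact_mod_cast hk0
  have hk1 : (1 : ℝ) ≤ k := by exact_mod_cast hk0
  have hn : (0 : ℝ) < n := by exact_mod_cast (by omega : 0 < n)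
  have hkn' : (k : ℝ) ≤ n := by exact_mod_cast hkn
  have hL0 : 0 ≤ L := by
    rw [hL]; exact Real.log_nonneg ((one_le_div hk).2 hkn')
  have hsL := Real.sq_sqrt hL0
  have hsk : 0 < √(k : ℝ) := Real.sqrt_pos.2 hk
  have hsk2 : √(k : ℝ) ^ 2 = k := Real.sq_sqrt hk.le
  have hδ0 : 0 ≤ δ := by linarith [Real.exp_pos (-(ε ^ 2 * k / 8))]
  have hτ0 : 0 ≤ √L - ε := by linarith
  have hupper : avg (fun g : ERGraph n =>
      if ((k : ℝ) ^ 2 / 2 + k * √k * (√L + 2 * ε)) / 2 < (dER n k g : ℝ) then (1 : ℝ) else 0)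
      ≤ δ := by
    refine (avg_dER_gt_le (choose_two_le k) (by positivity) (by positivity)).trans ?_
    calc _ ≤ Real.exp (k * (L + 1)) *
          Real.exp (-(k * √k * (√L + 2 * ε)) ^ 2 / (2 * ((k : ℝ) ^ 2 / 2))) := by
          rw [hL]
          gcongr
          exact choose_le_exp hk0 hkn
      _ = Real.exp (k * (1 - 4 * ε * √L - 4 * ε ^ 2)) := by
          rw [← Real.exp_add]
          congr 1
          have : (k * √k * (√L + 2 * ε)) ^ 2 = k ^ 3 * (L + 4 * ε * √L + 4 * ε ^ 2) := by
            rw [mul_pow, mul_pow, hsk2, ← hsL]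
            rw [Real.sqrt_sq (Real.sqrt_nonneg L)]
            ring
          rw [this]
          field_simp
          ring
      _ ≤ Real.exp (-k) := by
          apply Real.exp_le_exp.2
          nlinarith [sq_nonneg ε]
      _ ≤ k * Real.exp (-k) := by nlinarith [Real.exp_pos (-(k : ℝ))]
      _ ≤ δ := by
          have : 0 ≤ k * (k / n) * Real.exp (2 * L * x) := by positivity
          linarith
  have hlower := avg_dER_ge_of_second_moment (θ := 2 * (√L - ε) / √k)
    (w := ε / 2 * (k * √k)) hkn hδ0 hδ1 (overlapBound_nonneg k _ _ x)
    (fun A B hA hB => avg_tilt_mul_tilt_edgesIn_le hk0 (by positivity) (by positivity) hA hB)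
    ((sum_choose_mul_overlapBound_le hk0 hkn hε hL hx hεL hLk hxL hq hq2).trans (by linarith))
    (by
      intro A hA
      have h := one_sub_le_avg_tilt (θ := 2 * (√L - ε) / √k) (w := ε / 2 * (k * √k))
        (N := (k : ℝ) ^ 2 / 2) (T := edgesIn A) (by positivity)
        (by rw [card_edgesIn, hA]; exact choose_two_le k) (by positivity)
      refine le_trans ?_ h
      have h2 : Real.exp (-(ε / 2 * (k * √k)) ^ 2 / (2 * ((k : ℝ) ^ 2 / 2)) +
          (k : ℝ) ^ 2 / 2 * (2 * (√L - ε) / √k) ^ 4 / 8) ≤ Real.exp (-(ε ^ 2 * k / 8)) := by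
        apply Real.exp_le_exp.2
        have e1 : -(ε / 2 * (k * √k)) ^ 2 / (2 * ((k : ℝ) ^ 2 / 2)) = -(ε ^ 2 * k / 4) := by
          rw [mul_pow, mul_pow, hsk2]; field_simp; ring
        have e2 : (k : ℝ) ^ 2 / 2 * (2 * (√L - ε) / √k) ^ 4 / 8 = ((√L - ε) ^ 2) ^ 2 := by
          have : √(k : ℝ) ^ 4 = k ^ 2 := by rw [← hsk2]; ring_nf; rw [Real.sqrt_sq hsk.le]
          rw [div_pow, this]; field_simp; ring
        have e3 : (√L - ε) ^ 2 ≤ L := by nlinarith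
        have e4 : ((√L - ε) ^ 2) ^ 2 ≤ L ^ 2 := by gcongr
        rw [e1, e2]
        linarith
      linarith)
  have hcomb := avg_mono (Ω := ERGraph n)
    (f := fun g => (if (k.choose 2 * (1 + 2 * (√L - ε) / √k) - ε / 2 * (k * √k)) / 2 ≤
        (dER n k g : ℝ) then (1 : ℝ) else 0) -
      (if ((k : ℝ) ^ 2 / 2 + k * √k * (√L + 2 * ε)) / 2 < (dER n k g : ℝ) then (1 : ℝ) else 0))
    (h := fun g => if |(dER n k g : ℝ) - ((k : ℝ) ^ 2 / 4 + (k * √k) * √L / 2)| ≤ ε * (k * √k)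
        then (1 : ℝ) else 0) (by
    intro g
    by_cases hu : ((k : ℝ) ^ 2 / 2 + k * √k * (√L + 2 * ε)) / 2 < (dER n k g : ℝ)
    · simp only [if_pos hu]
      split_ifs <;> norm_num
    · simp only [if_neg hu, sub_zero]
      by_cases hl : (k.choose 2 * (1 + 2 * (√L - ε) / √k) - ε / 2 * (k * √k)) / 2 ≤
        (dER n k g : ℝ)
      · rw [if_pos hl, if_pos]
        rw [abs_le]
        push Not at hu
        refine ⟨?_, by linarith⟩
        have e : (k.choose 2 : ℝ) * (1 + 2 * (√L - ε) / √k) =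
            k ^ 2 / 2 - k / 2 + k * √k * (√L - ε) - √k * (√L - ε) := by
          rw [Nat.cast_choose_two]
          field_simp
          rw [← hsk2]
          ring_nf
          rw [Real.sqrt_sq hsk.le]
          ring
        rw [e] at hl
        have h1 : k * 2 ≤ k * (√k * ε) := by gcongr
        have h2 : √k * (4 * √L) ≤ √k * (k * ε) := by gcongr
        nlinarith [mul_pos hsk hε]
      · rw [if_neg hl]
        split_ifs <;> norm_num)
  rw [avg_sub] at hcomb
  linarith

lemma erMeasure_setOf (n : ℕ) (p : ERGraph n → Prop) [DecidablePred p] :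
    erMeasure n {g | p g} = ENNReal.ofReal (avg (fun g => if p g then (1 : ℝ) else 0)) := by
  rw [erMeasure, PMF.toMeasure_uniformOfFintype_apply _ (Set.toFinite _).measurableSet, avg,
    Finset.sum_boole, ENNReal.ofReal_div_of_pos (by positivity), ENNReal.ofReal_natCast,
    ENNReal.ofReal_natCast, Fintype.card_subtype]
  simp only [Set.mem_ofPred_eq]

lemma avg_ite_le_one {Ω : Type*} [Fintype Ω] (p : Ω → Prop) [DecidablePred p] :
    avg (fun g => if p g then (1 : ℝ) else 0) ≤ 1 := by
  rw [avg, Finset.sum_boole]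
  refine div_le_one_of_le₀ ?_ (by positivity)
  exact_mod_cast card_le_univ _

section growth
variable {K : ℕ → ℕ} {C c₁ c₂ : ℝ}

lemma tendsto_cast_of_rpow_le (hC : 0 < C) (hc₁ : 0 < c₁)
    (h : ∀ᶠ n : ℕ in atTop, c₁ * (n : ℝ) ^ C ≤ K n) :
    Tendsto (fun n => (K n : ℝ)) atTop atTop := by
  refine tendsto_atTop_mono' _ h (Tendsto.const_mul_atTop hc₁ ?_)
  exact (tendsto_rpow_atTop hC).comp tendsto_natCast_atTop_atTop

lemma tendsto_div_of_le_rpow (hC : C < 1) (h : ∀ᶠ n : ℕ in atTop, (K n : ℝ) ≤ c₂ * (n : ℝ) ^ C) :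
    Tendsto (fun n : ℕ => (K n : ℝ) / n) atTop (nhds 0) := by
  have h1 : Tendsto (fun n : ℕ => c₂ * (n : ℝ) ^ (-(1 - C))) atTop (nhds 0) := by
    simpa using ((tendsto_rpow_neg_atTop (sub_pos.2 hC)).comp
      tendsto_natCast_atTop_atTop).const_mul c₂
  refine squeeze_zero' (Eventually.of_forall fun n => by positivity) ?_ h1
  filter_upwards [h, eventually_gt_atTop 0] with n hn hn0
  have hn0' : (0 : ℝ) < n := by exact_mod_cast hn0
  rw [div_le_iff₀ hn0']
  refine hn.trans (le_of_eq ?_)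
  rw [mul_assoc]
  nth_rw 3 [← Real.rpow_one (n : ℝ)]
  rw [← Real.rpow_add hn0']
  congr 2; ring

lemma tendsto_log_div_atTop (hC0 : 0 < C) (hC : C < 1) (hc₁ : 0 < c₁)
    (h₁ : ∀ᶠ n : ℕ in atTop, c₁ * (n : ℝ) ^ C ≤ K n)
    (h : ∀ᶠ n : ℕ in atTop, (K n : ℝ) ≤ c₂ * (n : ℝ) ^ C) :
    Tendsto (fun n : ℕ => Real.log ((n : ℝ) / K n)) atTop atTop := by
  refine Real.tendsto_log_atTop.comp ?_
  have hpos : ∀ᶠ n : ℕ in atTop, (0 : ℝ) < (K n : ℝ) / n := by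
    filter_upwards [(tendsto_cast_of_rpow_le hC0 hc₁ h₁).eventually_gt_atTop 0,
      eventually_gt_atTop 0] with n h1 h2
    have : (0 : ℝ) < n := by exact_mod_cast h2
    positivity
  have := (tendsto_nhdsWithin_iff.2 ⟨tendsto_div_of_le_rpow hC h, hpos⟩).inv_tendsto_nhdsGT_zero
  refine this.congr fun n => ?_
  simp

lemma eventually_log_div_nonneg_and_le (hC0 : 0 < C) (hC : C < 1) (hc₁ : 0 < c₁)
    (h₁ : ∀ᶠ n : ℕ in atTop, c₁ * (n : ℝ) ^ C ≤ K n)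
    (h : ∀ᶠ n : ℕ in atTop, (K n : ℝ) ≤ c₂ * (n : ℝ) ^ C) :
    ∀ᶠ n : ℕ in atTop, 0 ≤ Real.log ((n : ℝ) / K n) ∧ Real.log ((n : ℝ) / K n) ≤ Real.log n := by
  filter_upwards [(tendsto_log_div_atTop hC0 hC hc₁ h₁ h).eventually_ge_atTop 0,
    (tendsto_cast_of_rpow_le hC0 hc₁ h₁).eventually_ge_atTop 1, eventually_gt_atTop 0]
    with n h1 h2 h3
  have : (0 : ℝ) < n := by exact_mod_cast h3
  refine ⟨h1, Real.log_le_log (by positivity) (div_le_self this.le h2)⟩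

lemma eventually_sq_log_div_le (hC0 : 0 < C) (hC : C < 1) (hc₁ : 0 < c₁)
    (h₁ : ∀ᶠ n : ℕ in atTop, c₁ * (n : ℝ) ^ C ≤ K n)
    (h : ∀ᶠ n : ℕ in atTop, (K n : ℝ) ≤ c₂ * (n : ℝ) ^ C) {η : ℝ} (hη : 0 < η) :
    ∀ᶠ n : ℕ in atTop, Real.log ((n : ℝ) / K n) ^ 2 ≤ η * K n := by
  have hlo := ((isLittleO_log_rpow_rpow_atTop 2 hC0).comp_tendsto
    tendsto_natCast_atTop_atTop).bound (mul_pos hη hc₁)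
  filter_upwards [eventually_log_div_nonneg_and_le hC0 hC hc₁ h₁ h, h₁, hlo] with n h2 h3 h4
  simp only [Function.comp_apply, Real.norm_eq_abs, Real.rpow_two] at h4
  rw [abs_of_nonneg (sq_nonneg _), abs_of_nonneg (by positivity)] at h4
  calc Real.log ((n : ℝ) / K n) ^ 2 ≤ Real.log n ^ 2 := pow_le_pow_left₀ h2.1 h2.2 2
    _ ≤ η * (c₁ * (n : ℝ) ^ C) := by linarith
    _ ≤ η * K n := by gcongr

lemma tendsto_overlap_ratio (hC0 : 0 < C) (hC : C < 1 / 2) (hc₁ : 0 < c₁) (hc₂ : 0 < c₂)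
    (h₁ : ∀ᶠ n : ℕ in atTop, c₁ * (n : ℝ) ^ C ≤ K n)
    (h : ∀ᶠ n : ℕ in atTop, (K n : ℝ) ≤ c₂ * (n : ℝ) ^ C) :
    Tendsto (fun n : ℕ => (K n : ℝ) * (K n / n) *
      Real.exp (2 * Real.log ((n : ℝ) / K n) * ((1 - 2 * C) / 4))) atTop (nhds 0) := by
  have hx : 0 < (1 - 2 * C) / 2 := by linarith
  have h1 : Tendsto (fun n : ℕ => c₂ ^ 2 * (n : ℝ) ^ (-((1 - 2 * C) / 2))) atTop (nhds 0) := by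
    simpa using ((tendsto_rpow_neg_atTop hx).comp tendsto_natCast_atTop_atTop).const_mul (c₂ ^ 2)
  refine squeeze_zero' (Eventually.of_forall fun n => by positivity) ?_ h1
  filter_upwards [eventually_log_div_nonneg_and_le hC0 (by linarith) hc₁ h₁ h, h,
    eventually_gt_atTop 0] with n h2 h3 hn0
  have hn0' : (0 : ℝ) < n := by exact_mod_cast hn0
  have h4 : Real.exp (2 * Real.log ((n : ℝ) / K n) * ((1 - 2 * C) / 4)) ≤
      (n : ℝ) ^ ((1 - 2 * C) / 2) := by
    rw [Real.rpow_def_of_pos hn0']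
    apply Real.exp_le_exp.2
    nlinarith [h2.2]
  calc _ ≤ (c₂ * (n : ℝ) ^ C) * ((c₂ * (n : ℝ) ^ C) / n) * (n : ℝ) ^ ((1 - 2 * C) / 2) := by
        gcongr
    _ = c₂ ^ 2 * ((n : ℝ) ^ C * (n : ℝ) ^ C * (n : ℝ) ^ (-1 : ℝ) *
          (n : ℝ) ^ ((1 - 2 * C) / 2)) := by
        rw [Real.rpow_neg_one]; ring
    _ = _ := by
        rw [← Real.rpow_add hn0', ← Real.rpow_add hn0', ← Real.rpow_add hn0']
        congr 2; ring

end growth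

/-- If `K = Θ(n^C)` with `C ∈ (0,1/2)` then w.h.p.
`d_{ER,K}(G₀) = K²/4 + K^{3/2}·√(log(n/K))/2 + o(K^{3/2})`. -/
theorem densest_subgraph_ER_second_order
    (K : ℕ → ℕ) (C : ℝ)
    (hC : C ∈ Set.Ioo (0 : ℝ) (1/2))
    (hK : ∃ c₁ c₂ : ℝ, 0 < c₁ ∧ 0 < c₂ ∧
      ∀ᶠ n : ℕ in atTop, c₁ * (n : ℝ) ^ C ≤ (K n : ℝ) ∧ (K n : ℝ) ≤ c₂ * (n : ℝ) ^ C) :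
    ∀ ε : ℝ, 0 < ε →
      Tendsto (fun n : ℕ =>
          erMeasure n {g : ERGraph n |
            |(dER n (K n) g : ℝ) -
              ((K n : ℝ) ^ 2 / 4 +
                (K n : ℝ) ^ ((3 : ℝ)/2) * Real.sqrt (Real.log ((n : ℝ) / (K n : ℝ))) / 2)| ≤
              ε * (K n : ℝ) ^ ((3 : ℝ)/2)})
        atTop (nhds 1) := by
  obtain ⟨c₁, c₂, hc₁, hc₂, hK⟩ := hK
  obtain ⟨hC0, hC2⟩ := hC
  have hC1 : C < 1 := by linarith
  have h₁ := hK.mono fun n h => h.1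
  have h₂ := hK.mono fun n h => h.2
  intro ε hε
  simp only [erMeasure_setOf]
  rw [← ENNReal.ofReal_one]
  refine ENNReal.tendsto_ofReal ?_
  have hKtop := tendsto_cast_of_rpow_le hC0 hc₁ h₁
  have hLtop := tendsto_log_div_atTop hC0 hC1 hc₁ h₁ h₂
  have hsLtop := Real.tendsto_sqrt_atTop.comp hLtop
  have hsKtop := Real.tendsto_sqrt_atTop.comp hKtop
  have hx : 0 < (1 - 2 * C) / 4 := by linarith
  rw [tendsto_order]
  refine ⟨fun b hb => ?_, fun b hb => Eventually.of_forall fun n =>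
    (avg_ite_le_one _).trans_lt hb⟩
  set δ := min 1 ((1 - b) / 8) with hδ
  have hδ0 : 0 < δ := by rw [hδ]; apply lt_min <;> linarith
  have hδb : b < 1 - 4 * δ := by
    have : δ ≤ (1 - b) / 8 := min_le_right _ _
    linarith
  have hqt := tendsto_overlap_ratio hC0 hC2 hc₁ hc₂ h₁ h₂
  have hexp : Tendsto (fun n => (K n : ℝ) * Real.exp (-(K n : ℝ))) atTop (nhds 0) := by
    have := (Real.tendsto_pow_mul_exp_neg_atTop_nhds_zero 1).comp hKtop
    simpa [Function.comp_def] using this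
  have hexp2 : Tendsto (fun n => 2 * Real.exp (-(ε ^ 2 * (K n : ℝ) / 8))) atTop (nhds 0) := by
    have h : Tendsto (fun n => ε ^ 2 * (K n : ℝ) / 8) atTop atTop :=
      (hKtop.const_mul_atTop (by positivity)).atTop_div_const (by norm_num)
    simpa using (Real.tendsto_exp_neg_atTop_nhds_zero.comp h).const_mul 2
  filter_upwards [hKtop.eventually_gt_atTop 0, eventually_gt_atTop 0,
    (tendsto_div_of_le_rpow hC1 h₂).eventually_le_const one_pos,
    eventually_sq_log_div_le hC0 hC1 hc₁ h₁ h₂ (η := 1 / 2) (by norm_num),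
    eventually_sq_log_div_le hC0 hC1 hc₁ h₁ h₂ (η := ε ^ 2 / 8) (by positivity),
    eventually_sq_log_div_le hC0 hC1 hc₁ h₁ h₂ (η := ε / 4) (by positivity),
    hLtop.eventually_ge_atTop 1,
    hsLtop.eventually_ge_atTop ε, hsLtop.eventually_ge_atTop (3 / ((1 - 2 * C) / 4 * ε)),
    hsLtop.eventually_ge_atTop (2 / (4 * ε)), hsKtop.eventually_ge_atTop (2 / ε),
    hqt.eventually_le_const (show (0 : ℝ) < min (1 / 2) (δ / 4) by positivity),
    hexp.eventually_le_const (show (0 : ℝ) < δ / 2 by positivity),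
    hexp2.eventually_le_const hδ0]
    with n hk0 hn0 hkn hL1 hL2 hL3 hLge hs1 hs2 hs3 hs4 hq he1 he2
  simp only [Function.comp_apply] at hs1 hs2 hs3 hs4
  have hn0' : (0 : ℝ) < n := by exact_mod_cast hn0
  have hkn' : K n ≤ n := by exact_mod_cast (div_le_one hn0').1 hkn
  rw [div_le_iff₀ (by positivity)] at hs2 hs3 hs4
  have hsq : √(Real.log ((n : ℝ) / K n)) ≤ Real.log ((n : ℝ) / K n) ^ 2 :=
    (Real.sqrt_le_iff.2 ⟨by positivity, by nlinarith⟩).trans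
      (le_self_pow₀ hLge two_ne_zero)
  have hq4 : min (1 / 2) (δ / 4) ≤ δ / 4 := min_le_right _ _
  refine hδb.trans_le ?_
  have hpow : (K n : ℝ) ^ ((3 : ℝ) / 2) = K n * √(K n : ℝ) := by
    rw [Real.sqrt_eq_rpow]
    nth_rw 2 [← Real.rpow_one (K n : ℝ)]
    rw [← Real.rpow_add hk0]
    norm_num
  rw [hpow]
  exact avg_dER_close_ge (by exact_mod_cast hk0) hkn' hε rfl hx hs1 (by linarith) (by linarith)
    (by linarith) (by linarith) hs4 (by linarith) hq (min_le_left _ _) (min_le_left _ _)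
    (by linarith) he2



end
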